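/- arXiv:1105.5983 — 2 statements merged into one kernel-verified Lean document; each statement's English description precedes it below -/
import Mathlib

section
/- Let q = n mod m with q > 0 and assume c(⌈n/m⌉) > c(⌈n/m⌉ − 1). Let f : {1,…,n} → {1,…,m} be nearly balanced (every fiber has size ⌊n/m⌋ or ⌈n/m⌉) and consider the profile in which every agent i plays (f(i), f(i)) (the same nearly balanced partition in both steps). Then the number of unordered pairs of distinct agents that have a strict deviation is exactly q·(⌈n/m⌉ choose 2). -/
/-- Number of agents (among `{1,…,n}`) choosing resource `r` under the choice function
`a` (one step of a two-step resource selection game). -/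
def rsgLoad (n : ℕ) (a : ℕ → ℕ) (r : ℕ) : ℕ :=
  ((Finset.Icc 1 n).filter (fun i => a i = r)).card

/-- Cost to agent `i` in the two-step resource selection game with cost function `c`,
first-step choices `a` and second-step choices `b`:
`c(L_1(a_i)) + c(L_2(b_i))`. -/
def rsgCost (n : ℕ) (c : ℕ → ℝ) (a b : ℕ → ℕ) (i : ℕ) : ℝ :=
  c (rsgLoad n a (a i)) + c (rsgLoad n b (b i))

/-- The pair of distinct agents `{i, i'}` has a strict deviation from the profile
`(a, b)`: there are alternative strategy pairs for `i` and `i'` (all other agents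
unchanged) under which both `i` and `i'` incur strictly smaller cost. -/
def rsgPairDev (n m : ℕ) (c : ℕ → ℝ) (a b : ℕ → ℕ) (i i' : ℕ) : Prop :=
  ∃ p q p' q' : ℕ, p ∈ Finset.Icc 1 m ∧ q ∈ Finset.Icc 1 m ∧
    p' ∈ Finset.Icc 1 m ∧ q' ∈ Finset.Icc 1 m ∧
    rsgCost n c (Function.update (Function.update a i p) i' p')
        (Function.update (Function.update b i q) i' q') i < rsgCost n c a b i ∧
    rsgCost n c (Function.update (Function.update a i p) i' p')
        (Function.update (Function.update b i q) i' q') i' < rsgCost n c a b i' 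


lemma aux_update (n : ℕ) (a : ℕ → ℕ) (i p t : ℕ) (hi : i ∈ Finset.Icc 1 n) :
    rsgLoad n (Function.update a i p) t + (if a i = t then 1 else 0)
      = rsgLoad n a t + (if p = t then 1 else 0) := by
  unfold rsgLoad
  simp only [Finset.card_filter]
  rw [← Finset.add_sum_erase _ _ hi, ← Finset.add_sum_erase _ (fun j => if a j = t then 1 else 0) hi]
  have : ∑ x ∈ (Finset.Icc 1 n).erase i, (if Function.update a i p x = t then 1 else 0)
      = ∑ x ∈ (Finset.Icc 1 n).erase i, (if a x = t then 1 else 0) := by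
    apply Finset.sum_congr rfl
    intro x hx
    rw [Function.update_of_ne (Finset.ne_of_mem_erase hx)]
  rw [this, Function.update_self]
  ring

lemma aux_update2 (n : ℕ) (a : ℕ → ℕ) (i i' p p' t : ℕ) (hi : i ∈ Finset.Icc 1 n)
    (hi' : i' ∈ Finset.Icc 1 n) (hne : i ≠ i') :
    rsgLoad n (Function.update (Function.update a i p) i' p') t
        + (if a i = t then 1 else 0) + (if a i' = t then 1 else 0)
      = rsgLoad n a t + (if p = t then 1 else 0) + (if p' = t then 1 else 0) := by
  have h1 := aux_update n a i p t hi
  have h2 := aux_update n (Function.update a i p) i' p' t hi'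
  rw [Function.update_of_ne hne.symm] at h2
  omega

lemma aux_le (n : ℕ) (a : ℕ → ℕ) (t : ℕ) : rsgLoad n a t ≤ n := by
  unfold rsgLoad
  exact (Finset.card_filter_le _ _).trans (by simp)

lemma aux_pos (n : ℕ) (a : ℕ → ℕ) (i : ℕ) (hi : i ∈ Finset.Icc 1 n) :
    1 ≤ rsgLoad n a (a i) := by
  unfold rsgLoad
  exact Finset.card_pos.mpr ⟨i, by simpa using hi⟩

lemma aux_two (n : ℕ) (a : ℕ → ℕ) (i i' : ℕ) (hi : i ∈ Finset.Icc 1 n)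
    (hi' : i' ∈ Finset.Icc 1 n) (hne : i ≠ i') (h : a i = a i') :
    2 ≤ rsgLoad n a (a i) := by
  unfold rsgLoad
  exact Finset.one_lt_card.mpr ⟨i, by simpa using hi, i', by simpa [h] using hi', hne⟩

lemma aux_mono (n : ℕ) (c : ℕ → ℝ) (hmono : ∀ i, 1 ≤ i → i < n → c i ≤ c (i + 1))
    (x y : ℕ) (hx : 1 ≤ x) (hxy : x ≤ y) (hy : y ≤ n) : c x ≤ c y := by
  induction y, hxy using Nat.le_induction with
  | base => exact le_rfl
  | succ y h ih => exact (ih (by omega)).trans (hmono y (by omega) (by omega))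

lemma aux_step (n m k : ℕ) (c : ℕ → ℝ) (f : ℕ → ℕ)
    (hmono : ∀ i, 1 ≤ i → i < n → c i ≤ c (i + 1))
    (hconv : ∀ i j, 1 ≤ i → i < j → j < n → c (i + 1) - c i ≤ c (j + 1) - c j)
    (hk : k < n)
    (hf : ∀ i ∈ Finset.Icc 1 n, f i ∈ Finset.Icc 1 m)
    (hfbal : ∀ r ∈ Finset.Icc 1 m, rsgLoad n f r = k ∨ rsgLoad n f r = k + 1)
    (i i' p p' : ℕ) (hi : i ∈ Finset.Icc 1 n) (hi' : i' ∈ Finset.Icc 1 n) (hne : i ≠ i')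
    (hp : p ∈ Finset.Icc 1 m) (hp' : p' ∈ Finset.Icc 1 m)
    (hno : ¬ (f i = f i' ∧ rsgLoad n f (f i) = k + 1)) :
    c (rsgLoad n f (f i)) + c (rsgLoad n f (f i')) ≤
      c (rsgLoad n (Function.update (Function.update f i p) i' p') p)
      + c (rsgLoad n (Function.update (Function.update f i p) i' p') p') := by
  have hx := aux_update2 n f i i' p p' p hi hi' hne
  have hy := aux_update2 n f i i' p p' p' hi hi' hne
  have hxn := aux_le n (Function.update (Function.update f i p) i' p') p
  have hyn := aux_le n (Function.update (Function.update f i p) i' p') p'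
  have bp := hfbal p hp
  have bp' := hfbal p' hp'
  have bi := hfbal _ (hf i hi)
  have bi' := hfbal _ (hf i' hi')
  have A1 := aux_pos n f i hi
  have B1 := aux_pos n f i' hi'
  have M := aux_mono n c hmono
  generalize rsgLoad n (Function.update (Function.update f i p) i' p') p = x at *
  generalize rsgLoad n (Function.update (Function.update f i p) i' p') p' = y at *
  by_cases hs : f i = f i'
  · have h2 := aux_two n f i i' hi hi' hne hs
    have hA : rsgLoad n f (f i) = k := by
      rcases bi with h | h
      · exact h
      · exact absurd ⟨hs, h⟩ hno
    rw [← hs] at hx hy ⊢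
    rw [hA] at h2 ⊢
    have hcv := hconv (k - 1) k (by omega) (by omega) hk
    rw [Nat.sub_add_cancel (by omega)] at hcv
    have key : (k ≤ x ∧ k ≤ y) ∨ (k + 1 ≤ x ∧ k - 1 ≤ y) ∨ (k - 1 ≤ x ∧ k + 1 ≤ y) := by
      by_cases h1 : f i = p
      · subst h1
        by_cases h3 : f i = p'
        · subst h3; simp at hx hy; omega
        · have : p' ≠ f i := fun h => h3 h.symm
          simp [h3, this] at hx hy; omega
      · have h1' : p ≠ f i := fun h => h1 h.symm
        by_cases h3 : f i = p'
        · subst h3; simp [h1, h1'] at hx hy; omega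
        · simp [h1, h3] at hx hy; omega
    rcases key with ⟨h, h'⟩ | ⟨h, h'⟩ | ⟨h, h'⟩
    · linarith [M k x (by omega) h hxn, M k y (by omega) h' hyn]
    · linarith [M (k+1) x (by omega) h hxn, M (k-1) y (by omega) h' hyn]
    · linarith [M (k-1) x (by omega) h hxn, M (k+1) y (by omega) h' hyn]
  · have key : (rsgLoad n f (f i) ≤ x ∧ rsgLoad n f (f i') ≤ y) ∨
        (rsgLoad n f (f i') ≤ x ∧ rsgLoad n f (f i) ≤ y) := by
      clear M hno hmono hconv hfbal hf
      grind
    rcases key with ⟨h, h'⟩ | ⟨h, h'⟩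
    · linarith [M _ x A1 h hxn, M _ y B1 h' hyn]
    · linarith [M _ x B1 h hxn, M _ y A1 h' hyn]

lemma aux_pairs (S : Finset ℕ) :
    ((S ×ˢ S).filter (fun p => p.1 < p.2)).card = S.card.choose 2 := by
  rw [← Finset.card_powersetCard]
  apply Finset.card_bij (fun p _ => ({p.1, p.2} : Finset ℕ))
  · rintro ⟨x, y⟩ h
    simp only [Finset.mem_filter, Finset.mem_product] at h
    rw [Finset.mem_powersetCard]
    refine ⟨?_, Finset.card_pair h.2.ne⟩
    intro z hz
    simp at hz
    rcases hz with rfl | rfl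
    exacts [h.1.1, h.1.2]
  · rintro ⟨x, y⟩ h ⟨x', y'⟩ h' he
    simp only [Finset.mem_filter, Finset.mem_product] at h h' he
    have e1 : x ∈ ({x', y'} : Finset ℕ) := he ▸ by simp
    have e2 : y ∈ ({x', y'} : Finset ℕ) := he ▸ by simp
    simp at e1 e2
    ext <;> simp <;> omega
  · intro T hT
    rw [Finset.mem_powersetCard] at hT
    obtain ⟨x, y, hxy, rfl⟩ := Finset.card_eq_two.mp hT.2
    have hx : x ∈ S := hT.1 (by simp)
    have hy : y ∈ S := hT.1 (by simp)
    rcases lt_or_gt_of_ne hxy with h | h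
    · exact ⟨(x, y), by simp [hx, hy, h], rfl⟩
    · exact ⟨(y, x), by simp [hx, hy, h], Finset.pair_comm _ _⟩

/-- In a two-step resource selection game with a nondecreasing convex cost function and
`q = n mod m > 0`, consider the profile in which every agent plays the same nearly
balanced partition `f` in both steps. Then the number of unordered pairs of distinct
agents that have a strict deviation is exactly `q·(⌈n/m⌉ choose 2)`
(with `⌈n/m⌉ = n/m + 1` since `n mod m > 0`). -/
theorem rsg_repeated_partition_deviating_pairs_count
    (n m : ℕ) (c : ℕ → ℝ) (f : ℕ → ℕ)
    (hm : 2 ≤ m) (hn : 1 ≤ n)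
    (hmono : ∀ i, 1 ≤ i → i < n → c i ≤ c (i + 1))
    (hconv : ∀ i j, 1 ≤ i → i < j → j < n → c (i + 1) - c i ≤ c (j + 1) - c j)
    (hq : 0 < n % m)
    (hstrict : c (n / m) < c (n / m + 1))
    (hf : ∀ i ∈ Finset.Icc 1 n, f i ∈ Finset.Icc 1 m)
    (hfbal : ∀ r ∈ Finset.Icc 1 m, rsgLoad n f r = n / m ∨ rsgLoad n f r = n / m + 1) :
    {p : ℕ × ℕ | p.1 ∈ Finset.Icc 1 n ∧ p.2 ∈ Finset.Icc 1 n ∧ p.1 < p.2 ∧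
        rsgPairDev n m c f f p.1 p.2}.ncard =
      (n % m) * Nat.choose (n / m + 1) 2 := by
  classical
  obtain ⟨k, hk⟩ : ∃ k, k = n / m := ⟨_, rfl⟩
  rw [← hk] at hstrict hfbal ⊢
  have hdm : m * k + n % m = n := by rw [hk]; exact Nat.div_add_mod n m
  have hqm : n % m < m := Nat.mod_lt _ (by omega)
  have hkn : k < n := by nlinarith
  set F := (Finset.Icc 1 m).filter (fun r => rsgLoad n f r = k + 1) with hF
  have hsum : ∑ r ∈ Finset.Icc 1 m, rsgLoad n f r = n := by
    have := Finset.card_eq_sum_card_fiberwise (s := Finset.Icc 1 n) (t := Finset.Icc 1 m)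
      (f := f) (fun i hi => hf i hi)
    simp only [Nat.card_Icc, Nat.add_sub_cancel] at this
    exact this.symm
  have hFc : F.card = n % m := by
    have h1 : ∑ r ∈ Finset.Icc 1 m, rsgLoad n f r
        = ∑ r ∈ Finset.Icc 1 m, (k + if rsgLoad n f r = k + 1 then 1 else 0) := by
      apply Finset.sum_congr rfl
      intro r hr
      rcases hfbal r hr with h | h <;> simp [h]
    rw [Finset.sum_add_distrib, ← Finset.card_filter, hsum] at h1
    rw [Finset.sum_const, Nat.card_Icc, Nat.add_sub_cancel, smul_eq_mul] at h1
    rw [hF]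
    linarith
  have hdev : ∀ i i', i ∈ Finset.Icc 1 n → i' ∈ Finset.Icc 1 n → i ≠ i' →
      (rsgPairDev n m c f f i i' ↔ (f i = f i' ∧ rsgLoad n f (f i) = k + 1)) := by
    intro i i' hi hi' hne
    constructor
    · rintro ⟨p, q, p', q', hp, hq1, hp', hq1', h1, h2⟩
      by_contra hno
      have s1 := aux_step n m k c f hmono hconv hkn hf hfbal i i' p p' hi hi' hne hp hp' hno
      have s2 := aux_step n m k c f hmono hconv hkn hf hfbal i i' q q' hi hi' hne hq1 hq1' hno
      unfold rsgCost at h1 h2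
      simp only [Function.update_self, Function.update_of_ne hne] at h1 h2
      linarith
    · rintro ⟨hs, hK⟩
      obtain ⟨s, hsm, hsl⟩ : ∃ s ∈ Finset.Icc 1 m, rsgLoad n f s = k := by
        by_contra hcon
        push Not at hcon
        have : F = Finset.Icc 1 m := by
          rw [hF, Finset.filter_eq_self]
          intro r hr
          exact (hfbal r hr).resolve_left (hcon r hr)
        rw [this] at hFc
        simp at hFc
        omega
      have hsne : f i ≠ s := by
        intro h; rw [h] at hK; omega
      have hsne' : s ≠ f i := hsne.symm
      refine ⟨s, f i, f i, s, hsm, hf i hi, hf i hi, hsm, ?_, ?_⟩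
      all_goals
        have u1 := aux_update2 n f i i' s (f i) s hi hi' hne
        have u2 := aux_update2 n f i i' s (f i) (f i) hi hi' hne
        have u3 := aux_update2 n f i i' (f i) s s hi hi' hne
        have u4 := aux_update2 n f i i' (f i) s (f i) hi hi' hne
        simp only [← hs, hsne, hsne', if_true, if_false, hsl, hK] at u1 u2 u3 u4
        unfold rsgCost
        simp only [Function.update_self, Function.update_of_ne hne, ← hs, hK]
      · rw [show rsgLoad n (Function.update (Function.update f i s) i' (f i)) s = k + 1 by omega,
          show rsgLoad n (Function.update (Function.update f i (f i)) i' s) (f i) = k by omega]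
        linarith
      · rw [show rsgLoad n (Function.update (Function.update f i s) i' (f i)) (f i) = k by omega,
          show rsgLoad n (Function.update (Function.update f i (f i)) i' s) s = k + 1 by omega]
        linarith
  have hset : {p : ℕ × ℕ | p.1 ∈ Finset.Icc 1 n ∧ p.2 ∈ Finset.Icc 1 n ∧ p.1 < p.2 ∧
        rsgPairDev n m c f f p.1 p.2} =
      ((F.biUnion (fun r =>
        (((Finset.Icc 1 n).filter (fun i => f i = r)) ×ˢ
          ((Finset.Icc 1 n).filter (fun i => f i = r))).filter (fun p => p.1 < p.2)) :
          Finset (ℕ × ℕ)) : Set (ℕ × ℕ)) := by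
    ext ⟨x, y⟩
    simp only [Set.mem_ofPred_eq, Finset.mem_coe, Finset.mem_biUnion, Finset.mem_filter,
      Finset.mem_product, hF]
    constructor
    · rintro ⟨hx, hy, hxy, hd⟩
      obtain ⟨h1, h2⟩ := (hdev x y hx hy hxy.ne).mp hd
      exact ⟨f x, ⟨hf x hx, h2⟩, ⟨⟨hx, rfl⟩, hy, h1.symm⟩, hxy⟩
    · rintro ⟨r, ⟨hr, hrl⟩, ⟨⟨hx, hxr⟩, hy, hyr⟩, hxy⟩
      exact ⟨hx, hy, hxy, (hdev x y hx hy hxy.ne).mpr ⟨hxr.trans hyr.symm, by rw [hxr]; exact hrl⟩⟩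
  rw [hset, Set.ncard_coe_finset, Finset.card_biUnion]
  · rw [Finset.sum_congr rfl (g := fun _ => (k + 1).choose 2)]
    · rw [Finset.sum_const, hFc, smul_eq_mul]
    · intro r hr
      rw [aux_pairs]
      have := (Finset.mem_filter.mp hr).2
      unfold rsgLoad at this
      rw [this]
  · intro r _ r' _ hrr
    simp only [Function.onFun]
    rw [Finset.disjoint_left]
    rintro ⟨x, y⟩ h h'
    simp only [Finset.mem_filter, Finset.mem_product] at h h'
    exact hrr (h.1.1.2.symm.trans h'.1.1.2)
end

section
/- If n < m² and n mod m > 0, then the two-step resource selection game has a profile that is nearly balanced in both steps, from which no single agent has a strictly cost-decreasing unilateral deviation and no pair of distinct agents has a strict deviation (i.e., a Nash equilibrium that is also a 2-strong equilibrium). -/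
/-- Agent `i` has a strictly cost-decreasing unilateral deviation from the profile
`(a, b)`. -/
def rsgUniDev (n m : ℕ) (c : ℕ → ℝ) (a b : ℕ → ℕ) (i : ℕ) : Prop :=
  ∃ p q : ℕ, p ∈ Finset.Icc 1 m ∧ q ∈ Finset.Icc 1 m ∧
    rsgCost n c (Function.update a i p) (Function.update b i q) i < rsgCost n c a b i

theorem rsg_load_le (n : ℕ) (a : ℕ → ℕ) (r : ℕ) : rsgLoad n a r ≤ n := by
  unfold rsgLoad
  exact (Finset.card_filter_le _ _).trans (by simp)

theorem rsg_mono (n : ℕ) (c : ℕ → ℝ) (hmono : ∀ i, 1 ≤ i → i < n → c i ≤ c (i + 1)) :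
    ∀ x y, 1 ≤ x → x ≤ y → y ≤ n → c x ≤ c y := by
  intro x y hx hxy
  induction y, hxy using Nat.le_induction with
  | base => intro _; exact le_rfl
  | succ y hy ih => intro h; exact (ih (by omega)).trans (hmono y (by omega) (by omega))

theorem rsg_load_count (n : ℕ) (a : ℕ → ℕ) (r : ℕ) :
    rsgLoad n a r = Nat.count (fun j => a (j + 1) = r) n := by
  unfold rsgLoad
  rw [Finset.card_filter]
  induction n with
  | zero => simp
  | succ n ih => rw [Finset.sum_Icc_succ_top (by omega), ih, Nat.count_succ]

theorem rsg_count_le_one (m d r s : ℕ) (hs : s ≤ m) :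
    Nat.count (fun t => (t + d) % m + 1 = r) s ≤ 1 := by
  rw [Nat.count_eq_card_filter_range, Finset.card_le_one]
  intro x hx y hy
  simp only [Finset.mem_filter, Finset.mem_range] at hx hy
  have h : x + d ≡ y + d [MOD m] := by
    have := hx.2.trans hy.2.symm
    unfold Nat.ModEq
    omega
  exact Nat.ModEq.eq_of_lt_of_lt (Nat.ModEq.add_right_cancel' _ h) (by omega) (by omega)

theorem rsg_count_one (m d r : ℕ) (hm : 0 < m) (hr : r ∈ Finset.Icc 1 m) :
    Nat.count (fun t => (t + d) % m + 1 = r) m = 1 := by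
  apply le_antisymm (rsg_count_le_one m d r m le_rfl)
  rw [Nat.count_eq_card_filter_range, Nat.one_le_iff_ne_zero, Finset.card_ne_zero]
  simp only [Finset.mem_Icc] at hr
  have hd := Nat.mod_lt d hm
  refine ⟨(r - 1 + (m - d % m)) % m, ?_⟩
  simp only [Finset.mem_filter, Finset.mem_range]
  refine ⟨Nat.mod_lt _ hm, ?_⟩
  have e : (r - 1 + (m - d % m)) + d = (r - 1) + m * (1 + d / m) := by
    have := Nat.div_add_mod d m
    rw [Nat.mul_add]
    omega
  rw [Nat.mod_add_mod, e, Nat.add_mul_mod_self_left, Nat.mod_eq_of_lt (by omega)]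
  omega

theorem rsg_count_block (m : ℕ) (g : ℕ → ℕ) (hm : 0 < m) (r q s : ℕ) (hs : s ≤ m) :
    Nat.count (fun j => (j % m + g (j / m)) % m + 1 = r) (m * q + s) =
    Nat.count (fun j => (j % m + g (j / m)) % m + 1 = r) (m * q) +
    Nat.count (fun t => (t + g q) % m + 1 = r) s := by
  rw [Nat.count_add]
  congr 1
  rw [Nat.count_eq_card_filter_range, Nat.count_eq_card_filter_range]
  congr 1
  apply Finset.filter_congr
  intro t ht
  rw [Finset.mem_range] at ht
  rw [Nat.mul_add_mod, Nat.mul_add_div hm, Nat.mod_eq_of_lt (by omega : t < m),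
    Nat.div_eq_of_lt (by omega : t < m)]
  simp only [Nat.add_zero]

theorem rsg_load_block (n m : ℕ) (g : ℕ → ℕ) (hm : 0 < m) (r : ℕ) (hr : r ∈ Finset.Icc 1 m) :
    rsgLoad n (fun i => ((i - 1) % m + g ((i - 1) / m)) % m + 1) r = n / m ∨
    rsgLoad n (fun i => ((i - 1) % m + g ((i - 1) / m)) % m + 1) r = n / m + 1 := by
  rw [rsg_load_count]
  simp only [Nat.add_sub_cancel]
  have full : ∀ q, Nat.count (fun j => (j % m + g (j / m)) % m + 1 = r) (m * q) = q := by
    intro q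
    induction q with
    | zero => simp
    | succ q ih =>
      rw [Nat.mul_succ, rsg_count_block m g hm r q m le_rfl, ih, rsg_count_one m _ r hm hr]
  have h := rsg_count_block m g hm r (n / m) (n % m) (Nat.mod_lt n hm).le
  rw [full, Nat.div_add_mod] at h
  have h1 := rsg_count_le_one m (g (n / m)) r (n % m) (Nat.mod_lt n hm).le
  omega

theorem rsg_split_one (n : ℕ) (a : ℕ → ℕ) (i r : ℕ) (hi : i ∈ Finset.Icc 1 n) :
    rsgLoad n a r = (if a i = r then 1 else 0) +
      (((Finset.Icc 1 n).erase i).filter (fun j => a j = r)).card := by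
  unfold rsgLoad
  rw [Finset.card_filter, Finset.card_filter, Finset.add_sum_erase _ (fun j => if a j = r then 1 else 0) hi]

theorem rsg_split_two (n : ℕ) (a : ℕ → ℕ) (i i' r : ℕ) (hne : i ≠ i')
    (hi : i ∈ Finset.Icc 1 n) (hi' : i' ∈ Finset.Icc 1 n) :
    rsgLoad n a r = (if a i = r then 1 else 0) + ((if a i' = r then 1 else 0) +
      ((((Finset.Icc 1 n).erase i).erase i').filter (fun j => a j = r)).card) := by
  have hi2 : i' ∈ (Finset.Icc 1 n).erase i := Finset.mem_erase.2 ⟨hne.symm, hi'⟩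
  rw [rsg_split_one n a i r hi, Finset.card_filter, Finset.card_filter,
    Finset.add_sum_erase _ (fun j => if a j = r then 1 else 0) hi2]

theorem rsg_uni (n m k : ℕ) (a : ℕ → ℕ) (i p : ℕ) (hi : i ∈ Finset.Icc 1 n)
    (hai : a i ∈ Finset.Icc 1 m) (hp : p ∈ Finset.Icc 1 m)
    (ha : ∀ r ∈ Finset.Icc 1 m, rsgLoad n a r = k ∨ rsgLoad n a r = k + 1) :
    1 ≤ rsgLoad n a (a i) ∧ rsgLoad n a (a i) ≤ rsgLoad n (Function.update a i p) p := by
  have h1 := rsg_split_one n a i (a i) hi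
  have h2 := rsg_split_one n a i p hi
  have h3 := rsg_split_one n (Function.update a i p) i p hi
  have h4 : (((Finset.Icc 1 n).erase i).filter (fun j => Function.update a i p j = p)) =
      (((Finset.Icc 1 n).erase i).filter (fun j => a j = p)) := by
    apply Finset.filter_congr
    intro j hj
    rw [Function.update_of_ne (Finset.ne_of_mem_erase hj)]
  rw [h4, Function.update_self, if_pos rfl] at h3
  rw [if_pos rfl] at h1
  have := ha _ hai
  have := ha _ hp
  by_cases e : a i = p
  · subst e
    omega
  · rw [if_neg e] at h2
    omega

set_option maxHeartbeats 1000000 in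
theorem rsg_arith (k r r' p p' x y u v : ℕ) (B : ℕ → ℕ)
    (ex : x = (if p = p then 1 else 0) + ((if p' = p then 1 else 0) + B p))
    (ey : y = (if p = p' then 1 else 0) + ((if p' = p' then 1 else 0) + B p'))
    (eu : u = (if r = r then 1 else 0) + ((if r' = r then 1 else 0) + B r))
    (ev : v = (if r = r' then 1 else 0) + ((if r' = r' then 1 else 0) + B r'))
    (h1 : u = k ∨ u = k + 1) (h2 : v = k ∨ v = k + 1)
    (h3 : (if r = p then 1 else 0) + ((if r' = p then 1 else 0) + B p) = k ∨
      (if r = p then 1 else 0) + ((if r' = p then 1 else 0) + B p) = k + 1)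
    (h4 : (if r = p' then 1 else 0) + ((if r' = p' then 1 else 0) + B p') = k ∨
      (if r = p' then 1 else 0) + ((if r' = p' then 1 else 0) + B p') = k + 1) :
    1 ≤ u ∧ 1 ≤ v ∧ 1 ≤ x ∧ 1 ≤ y ∧ ((u ≤ x ∧ v ≤ y) ∨
      (u = k + 1 ∧ v = k ∧ x = k ∧ k + 1 ≤ y) ∨
      (v = k + 1 ∧ u = k ∧ y = k ∧ k + 1 ≤ x) ∨
      (u = k ∧ v = k ∧ x + 1 = k ∧ k + 1 ≤ y) ∨
      (u = k ∧ v = k ∧ y + 1 = k ∧ k + 1 ≤ x) ∨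
      (r = r' ∧ u = k + 1 ∧ v = k + 1 ∧ ((k ≤ x ∧ k + 1 ≤ y ∧ 1 ≤ k) ∨
        (k ≤ y ∧ k + 1 ≤ x ∧ 1 ≤ k)))) := by
  rw [if_pos rfl] at ex eu
  rw [if_pos (rfl : p' = p')] at ey
  rw [if_pos (rfl : r' = r')] at ev
  refine ⟨by omega, by omega, by omega, by omega, ?_⟩
  have s1 : (if r' = r then 1 else 0) = (if r = r' then 1 else 0) := by simp [eq_comm]
  have s2 : (if p' = p then 1 else 0) = (if p = p' then 1 else 0) := by simp [eq_comm]
  rw [s1] at eu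
  rw [s2] at ex
  clear s1 s2
  by_cases e1 : r = r' <;> by_cases e2 : p = p' <;> by_cases e3 : r = p <;>
    by_cases e4 : r = p' <;> by_cases e5 : r' = p <;> by_cases e6 : r' = p' <;>
    first
    | (exfalso; clear ex ey eu ev h1 h2 h3 h4; omega)
    | skip
  all_goals
    first | rw [if_pos e1] at eu ev | rw [if_neg e1] at eu ev
    first | rw [if_pos e2] at ex ey | rw [if_neg e2] at ex ey
    first | rw [if_pos e3] at h3 | rw [if_neg e3] at h3
    first | rw [if_pos e4] at h4 | rw [if_neg e4] at h4
    first | rw [if_pos e5] at h3 | rw [if_neg e5] at h3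
    first | rw [if_pos e6] at h4 | rw [if_neg e6] at h4
    try have c1 := congrArg B e1
    try have c2 := congrArg B e2
    try have c3 := congrArg B e3
    try have c4 := congrArg B e4
    try have c5 := congrArg B e5
    try have c6 := congrArg B e6
    clear e2 e3 e4 e5 e6
    rcases h1 with h1 | h1 <;> rcases h2 with h2 | h2 <;> rcases h3 with h3 | h3 <;>
      rcases h4 with h4 | h4 <;>
    first
    | (exfalso; omega)
    | (left; omega)
    | (right; left; omega)
    | (right; right; left; omega)
    | (right; right; right; left; omega)
    | (right; right; right; right; left; omega)
    | (right; right; right; right; right; omega)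
    | omega

theorem rsg_step (n m k : ℕ) (c : ℕ → ℝ) (a : ℕ → ℕ) (i i' p p' : ℕ) (hne : i ≠ i')
    (hi : i ∈ Finset.Icc 1 n) (hi' : i' ∈ Finset.Icc 1 n)
    (hai : a i ∈ Finset.Icc 1 m) (hai' : a i' ∈ Finset.Icc 1 m)
    (hp : p ∈ Finset.Icc 1 m) (hp' : p' ∈ Finset.Icc 1 m)
    (ha : ∀ r ∈ Finset.Icc 1 m, rsgLoad n a r = k ∨ rsgLoad n a r = k + 1)
    (cm : ∀ x y, 1 ≤ x → x ≤ y → y ≤ n → c x ≤ c y)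
    (hconv : ∀ i j, 1 ≤ i → i < j → j < n → c (i + 1) - c i ≤ c (j + 1) - c j)
    (hk : k + 1 ≤ n) :
    let x := rsgLoad n (Function.update (Function.update a i p) i' p') p
    let y := rsgLoad n (Function.update (Function.update a i p) i' p') p'
    let u := rsgLoad n a (a i)
    let v := rsgLoad n a (a i')
    let D := c (k + 1) - c k
    (c u ≤ c x ∧ c v ≤ c y) ∨ (c u - D ≤ c x ∧ c v + D ≤ c y) ∨
    (c u + D ≤ c x ∧ c v - D ≤ c y) ∨
    (a i = a i' ∧ ((c u ≤ c x ∧ c v - D ≤ c y) ∨ (c u - D ≤ c x ∧ c v ≤ c y))) := by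
  intro x y u v D
  have hx : x ≤ n := rsg_load_le _ _ _
  have hy : y ≤ n := rsg_load_le _ _ _
  have key : 1 ≤ u ∧ 1 ≤ v ∧ 1 ≤ x ∧ 1 ≤ y ∧ ((u ≤ x ∧ v ≤ y) ∨
      (u = k + 1 ∧ v = k ∧ x = k ∧ k + 1 ≤ y) ∨
      (v = k + 1 ∧ u = k ∧ y = k ∧ k + 1 ≤ x) ∨
      (u = k ∧ v = k ∧ x + 1 = k ∧ k + 1 ≤ y) ∨
      (u = k ∧ v = k ∧ y + 1 = k ∧ k + 1 ≤ x) ∨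
      (a i = a i' ∧ u = k + 1 ∧ v = k + 1 ∧ ((k ≤ x ∧ k + 1 ≤ y ∧ 1 ≤ k) ∨
        (k ≤ y ∧ k + 1 ≤ x ∧ 1 ≤ k)))) := by
    have hF : ∀ r, (((Finset.Icc 1 n).erase i).erase i').filter
        (fun j => Function.update (Function.update a i p) i' p' j = r) =
        (((Finset.Icc 1 n).erase i).erase i').filter (fun j => a j = r) := by
      intro r
      apply Finset.filter_congr
      intro j hj
      rw [Function.update_of_ne (Finset.ne_of_mem_erase hj), Function.update_of_ne
        (Finset.ne_of_mem_erase (Finset.mem_of_mem_erase hj))]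
    have new : ∀ r, rsgLoad n (Function.update (Function.update a i p) i' p') r =
        (if p = r then 1 else 0) + ((if p' = r then 1 else 0) +
      ((((Finset.Icc 1 n).erase i).erase i').filter (fun j => a j = r)).card) := by
      intro r
      rw [rsg_split_two n _ i i' r hne hi hi', hF, Function.update_self,
        Function.update_of_ne hne, Function.update_self]
    have old := fun r => rsg_split_two n a i i' r hne hi hi'
    generalize hB : (fun r => ((((Finset.Icc 1 n).erase i).erase i').filter
      (fun j => a j = r)).card) = B at *
    have hB' : ∀ r, ((((Finset.Icc 1 n).erase i).erase i').filter
      (fun j => a j = r)).card = B r := fun r => congrFun hB r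
    simp only [hB'] at new old
    have ex : x = _ := new p
    have ey : y = _ := new p'
    have eu : u = _ := old (a i)
    have ev : v = _ := old (a i')
    have h1 := ha _ hai
    have h2 := ha _ hai'
    have h3 := ha _ hp
    have h4 := ha _ hp'
    change u = k ∨ u = k + 1 at h1
    change v = k ∨ v = k + 1 at h2
    rw [old p] at h3
    rw [old p'] at h4
    clear_value x y u v
    clear hB hB' new old hF ha hai hai' hp hp' cm hconv
    generalize a i = r at *
    generalize a i' = r' at *
    exact rsg_arith k r r' p p' x y u v B ex ey eu ev h1 h2 h3 h4
  obtain ⟨pu, pv, px, py, h⟩ := key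
  have hD : D = c (k + 1) - c k := rfl
  clear_value x y u v D
  rcases h with h | ⟨rfl, rfl, rfl, h⟩ | ⟨rfl, rfl, rfl, h⟩ | ⟨rfl, h0, h1, h⟩ |
    ⟨rfl, h0, h1, h⟩ | ⟨e, rfl, rfl, h⟩
  · exact Or.inl ⟨cm _ _ pu h.1 hx, cm _ _ pv h.2 hy⟩
  · right; left
    have := cm _ _ (by omega) h hy
    constructor <;> linarith
  · right; right; left
    have := cm _ _ (by omega) h hx
    constructor <;> linarith
  · right; left
    have h2 := cm _ _ (by omega) h hy
    have h3 := hconv x (x + 1) px (by omega) (by omega)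
    subst h0
    subst h1
    constructor <;> linarith
  · right; right; left
    have h2 := cm _ _ (by omega) h hx
    have h3 := hconv y (y + 1) py (by omega) (by omega)
    subst h0
    subst h1
    constructor <;> linarith
  · right; right; right
    refine ⟨e, ?_⟩
    rcases h with ⟨h1, h2, h3⟩ | ⟨h1, h2, h3⟩
    · right
      have := cm _ _ h3 h1 hx
      have := cm _ _ (by omega) h2 hy
      constructor <;> linarith
    · left
      have := cm _ _ h3 h1 hy
      have := cm _ _ (by omega) h2 hx
      constructor <;> linarith

/-- If `n < m²` and `n mod m > 0`, the two-step resource selection game (with a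
nondecreasing convex cost function) has a profile that is nearly balanced in both
steps, from which no single agent has a strictly cost-decreasing unilateral deviation
and no pair of distinct agents has a strict deviation (a Nash equilibrium that is also
a 2-strong equilibrium). (Here `⌊n/m⌋ = n/m` and `⌈n/m⌉ = n/m + 1` since
`n mod m > 0`.) -/
theorem rsg_two_step_exists_two_strong_equilibrium
    (n m : ℕ) (c : ℕ → ℝ)
    (hm : 2 ≤ m) (hn : 1 ≤ n)
    (hmono : ∀ i, 1 ≤ i → i < n → c i ≤ c (i + 1))
    (hconv : ∀ i j, 1 ≤ i → i < j → j < n → c (i + 1) - c i ≤ c (j + 1) - c j)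
    (hnm : n < m * m) (hq : 0 < n % m) :
    ∃ a b : ℕ → ℕ,
      (∀ i ∈ Finset.Icc 1 n, a i ∈ Finset.Icc 1 m ∧ b i ∈ Finset.Icc 1 m) ∧
      (∀ r ∈ Finset.Icc 1 m, rsgLoad n a r = n / m ∨ rsgLoad n a r = n / m + 1) ∧
      (∀ r ∈ Finset.Icc 1 m, rsgLoad n b r = n / m ∨ rsgLoad n b r = n / m + 1) ∧
      (∀ i ∈ Finset.Icc 1 n, ¬ rsgUniDev n m c a b i) ∧
      (∀ i ∈ Finset.Icc 1 n, ∀ i' ∈ Finset.Icc 1 n, i ≠ i' →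
        ¬ rsgPairDev n m c a b i i') := by
  have hmn : n / m < m := Nat.div_lt_of_lt_mul hnm
  have hnk : m * (n / m) + n % m = n := Nat.div_add_mod n m
  have hk : n / m + 1 ≤ n := by nlinarith [Nat.zero_le (n / m)]
  have cm : ∀ x y, 1 ≤ x → x ≤ y → y ≤ n → c x ≤ c y := rsg_mono n c hmono
  set k := n / m with hkdef
  let a : ℕ → ℕ := fun i => ((i - 1) % m + 0) % m + 1
  let b : ℕ → ℕ := fun i => ((i - 1) % m + (i - 1) / m) % m + 1
  have hm0 : 0 < m := by omega
  have hab : ∀ i ∈ Finset.Icc 1 n, a i ∈ Finset.Icc 1 m ∧ b i ∈ Finset.Icc 1 m := by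
    intro i _
    have h1 := Nat.mod_lt ((i - 1) % m + 0) hm0
    have h2 := Nat.mod_lt ((i - 1) % m + (i - 1) / m) hm0
    simp only [Finset.mem_Icc, a, b]
    omega
  have ha : ∀ r ∈ Finset.Icc 1 m, rsgLoad n a r = k ∨ rsgLoad n a r = k + 1 := fun r hr =>
    rsg_load_block n m (fun _ => 0) hm0 r hr
  have hb : ∀ r ∈ Finset.Icc 1 m, rsgLoad n b r = k ∨ rsgLoad n b r = k + 1 := fun r hr =>
    rsg_load_block n m (fun q => q) hm0 r hr
  have hinj : ∀ i ∈ Finset.Icc 1 n, ∀ i' ∈ Finset.Icc 1 n, i ≠ i' →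
      ¬ (a i = a i' ∧ b i = b i') := by
    rintro i hi i' hi' hne ⟨h1, h2⟩
    simp only [Finset.mem_Icc] at hi hi'
    simp only [a, b, Nat.add_right_cancel_iff, Nat.add_zero, Nat.mod_mod] at h1 h2
    have q1 : (i - 1) / m < m := Nat.div_lt_of_lt_mul (by omega)
    have q2 : (i' - 1) / m < m := Nat.div_lt_of_lt_mul (by omega)
    rw [h1] at h2
    have h3 : (i - 1) / m = (i' - 1) / m :=
      Nat.ModEq.eq_of_lt_of_lt (Nat.ModEq.add_left_cancel' _ h2) q1 q2
    have e1 := Nat.div_add_mod (i - 1) m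
    have e2 := Nat.div_add_mod (i' - 1) m
    rw [h1, h3, e2] at e1
    omega
  refine ⟨a, b, hab, ha, hb, ?_, ?_⟩
  · rintro i hi ⟨p, q, hp, hq', h⟩
    have A := rsg_uni n m k a i p hi (hab i hi).1 hp ha
    have B := rsg_uni n m k b i q hi (hab i hi).2 hq' hb
    unfold rsgCost at h
    simp only [Function.update_self] at h
    have h1 := cm _ _ A.1 A.2 (rsg_load_le _ _ _)
    have h2 := cm _ _ B.1 B.2 (rsg_load_le _ _ _)
    linarith
  · rintro i hi i' hi' hne ⟨p, q, p', q', hp, hq1, hp', hq1', h, h'⟩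
    have A := rsg_step n m k c a i i' p p' hne hi hi' (hab i hi).1 (hab i' hi').1 hp hp' ha
      cm hconv hk
    have B := rsg_step n m k c b i i' q q' hne hi hi' (hab i hi).2 (hab i' hi').2 hq1 hq1' hb
      cm hconv hk
    have I := hinj i hi i' hi' hne
    unfold rsgCost at h h'
    simp only [Function.update_self, Function.update_of_ne hne] at h h'
    rcases A with A | A | A | ⟨A0, A⟩
    all_goals rcases B with B | B | B | ⟨B0, B⟩
    all_goals first
      | exact I ⟨A0, B0⟩
      | linarith [A.1, A.2, B.1, B.2]
      | (rcases A with A | A <;> linarith [A.1, A.2, B.1, B.2])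
      | (rcases B with B | B <;> linarith [A.1, A.2, B.1, B.2])
end
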